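/- arXiv:2111.07757 — 8 statements merged into one kernel-verified Lean document; each statement's English description precedes it below -/
import Mathlib

section
/- For every real number c, as x → ∞ (x real, x > 0), Γ(x+c)/Γ(x) = x^c · (1 − c(1−c)/(2x) + O(x^{−2})); equivalently, Γ(x+c)/Γ(x) − x^c + (c(1−c)/2)·x^{c−1} = O(x^{c−2}) as x → ∞. -/
open Filter Asymptotics Real

lemma abs_log_one_add_sub_le {t : ℝ} (ht : |t| ≤ 1 / 2) :
    |log (1 + t) - t + t ^ 2 / 2| ≤ 2 * |t| ^ 3 := by
  have h := abs_log_sub_add_sum_range_le (x := -t) (by rw [abs_neg]; linarith) 2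
  simp only [Finset.sum_range_succ, Finset.sum_range_zero, abs_neg, sub_neg_eq_add] at h
  have h2 : |t| ^ 3 / (1 - |t|) ≤ 2 * |t| ^ 3 := by
    rw [div_le_iff₀ (by linarith)]
    nlinarith [pow_nonneg (abs_nonneg t) 3]
  refine le_trans (le_of_eq ?_) (h.trans h2)
  congr 1
  norm_num
  ring

lemma log_Gamma_add_one {y : ℝ} (hy : 0 < y) :
    log (Gamma (y + 1)) = log (Gamma y) + log y := by
  rw [Gamma_add_one hy.ne', log_mul hy.ne' (Gamma_pos_of_pos hy).ne', add_comm]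

/-- The error term in the first-order expansion of `log (Γ(x + c) / (Γ(x) x ^ c))`. -/
noncomputable def logGammaRatioError (c x : ℝ) : ℝ :=
  log (Gamma (x + c)) - log (Gamma x) - c * log x + c * (1 - c) / 2 / x

lemma tendsto_log_Gamma_add_nat_sub {x : ℝ} (hx : 0 < x) :
    Tendsto (fun n : ℕ => log (Gamma (x + (n + 1 : ℕ))) - x * log n - log (n.factorial))
      atTop (nhds 0) := by
  have h := (BohrMollerup.tendsto_log_gamma hx).const_sub (log (Gamma x))
  rw [sub_self] at h
  refine h.congr fun n => ?_
  have := BohrMollerup.f_add_nat_eq (f := log ∘ Gamma) (fun {y} hy => log_Gamma_add_one hy) hx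
    (n + 1)
  simp only [Function.comp_apply] at this
  rw [this, BohrMollerup.logGammaSeq]
  ring

lemma tendsto_logGammaRatioError_add_nat {c x : ℝ} (hx : 0 < x) (hxc : 0 < x + c) :
    Tendsto (fun n : ℕ => logGammaRatioError c (x + (n + 1 : ℕ))) atTop (nhds 0) := by
  have hinf : Tendsto (fun n : ℕ => x + ((n + 1 : ℕ) : ℝ)) atTop atTop :=
    tendsto_atTop_add_const_left _ _
      (tendsto_natCast_atTop_atTop.comp (tendsto_add_atTop_nat 1))
  have hlog : Tendsto (fun n : ℕ => log (n + (x + 1)) - log n) atTop (nhds 0) :=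
    (tendsto_log_comp_add_sub_log (x + 1)).comp tendsto_natCast_atTop_atTop
  have h := (((tendsto_log_Gamma_add_nat_sub hxc).sub (tendsto_log_Gamma_add_nat_sub hx)).sub
    (hlog.const_mul c)).add (hinf.const_div_atTop (c * (1 - c) / 2))
  simp only [sub_zero, mul_zero, add_zero] at h
  refine h.congr fun n => ?_
  have e1 : x + ((n + 1 : ℕ) : ℝ) = n + (x + 1) := by push_cast; ring
  have e2 : x + c + ((n + 1 : ℕ) : ℝ) = x + ((n + 1 : ℕ) : ℝ) + c := by ring
  rw [logGammaRatioError, e2, e1]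
  ring

lemma abs_logGammaRatioError_add_one_sub_le {c x : ℝ} (hx : 2 * |c| + 2 ≤ x) :
    |logGammaRatioError c (x + 1) - logGammaRatioError c x| ≤
      (2 * |c| ^ 3 + 2 * |c| + |c * (1 - c) / 2|) / x ^ 3 := by
  have hc := abs_nonneg c
  have hx0 : 0 < x := by linarith
  have hxc : 0 < x + c := by linarith [neg_abs_le c]
  have h1 := abs_log_one_add_sub_le (t := c / x) (by
    rw [abs_div, abs_of_pos hx0, div_le_iff₀ hx0]; linarith)
  have h2 := abs_log_one_add_sub_le (t := 1 / x) (by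
    rw [abs_div, abs_of_pos hx0, abs_one, div_le_iff₀ hx0]; linarith)
  have e1 : log (1 + c / x) = log (x + c) - log x := by
    rw [← log_div hxc.ne' hx0.ne']; congr 1; field_simp
  have e2 : log (1 + 1 / x) = log (x + 1) - log x := by
    rw [← log_div (by positivity) hx0.ne']; congr 1; field_simp
  rw [abs_div, abs_of_pos hx0] at h1 h2
  have h3 : |c * (1 - c) / 2 / (x ^ 2 * (x + 1))| ≤ |c * (1 - c) / 2| / x ^ 3 := by
    rw [abs_div, abs_of_pos (show 0 < x ^ 2 * (x + 1) by positivity)]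
    gcongr
    nlinarith [sq_nonneg x]
  have key : logGammaRatioError c (x + 1) - logGammaRatioError c x =
      (log (1 + c / x) - c / x + (c / x) ^ 2 / 2)
        - c * (log (1 + 1 / x) - 1 / x + (1 / x) ^ 2 / 2)
        + c * (1 - c) / 2 / (x ^ 2 * (x + 1)) := by
    rw [e1, e2, logGammaRatioError, logGammaRatioError, add_right_comm x 1 c,
      log_Gamma_add_one hxc, log_Gamma_add_one hx0]
    field_simp
    ring
  rw [key]
  refine (abs_add_le _ _).trans ?_
  refine (add_le_add_left (abs_sub _ _) _).trans ?_
  rw [abs_mul]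
  have h4 := mul_le_mul_of_nonneg_left h2 hc
  refine (add_le_add (add_le_add h1 h4) h3).trans (le_of_eq ?_)
  rw [abs_one]
  field_simp

lemma abs_logGammaRatioError_le {c x : ℝ} (hx : 2 * |c| + 2 ≤ x) :
    |logGammaRatioError c x| ≤ (2 * |c| ^ 3 + 2 * |c| + |c * (1 - c) / 2|) / x ^ 2 := by
  set K := 2 * |c| ^ 3 + 2 * |c| + |c * (1 - c) / 2| with hK
  have hK0 : 0 ≤ K := by positivity
  have hc := abs_nonneg c
  have hx0 : 0 < x := by linarith
  have hxc : 0 < x + c := by linarith [neg_abs_le c]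
  have step (y : ℝ) (hy : 2 * |c| + 2 ≤ y) :
      |logGammaRatioError c (y + 1) - logGammaRatioError c y| ≤
        K / y ^ 2 - K / (y + 1) ^ 2 := by
    have hy0 : 0 < y := by linarith
    refine (abs_logGammaRatioError_add_one_sub_le hy).trans ?_
    rw [← hK, div_sub_div _ _ (by positivity) (by positivity),
      div_le_div_iff₀ (by positivity) (by positivity)]
    have : 0 ≤ K * y ^ 2 * (y ^ 2 - y - 1) := mul_nonneg (by positivity) (by nlinarith)
    nlinarith
  have bound (n : ℕ) : |logGammaRatioError c (x + n) - logGammaRatioError c x| ≤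
      K / x ^ 2 - K / (x + n) ^ 2 := by
    induction n with
    | zero => simp
    | succ n ih =>
      have h := step (x + n) (by linarith [n.cast_nonneg (α := ℝ)])
      push_cast
      rw [← add_assoc]
      have := abs_sub_le (logGammaRatioError c (x + n + 1)) (logGammaRatioError c (x + n))
        (logGammaRatioError c x)
      linarith
  have hlim := ((tendsto_logGammaRatioError_add_nat hx0 hxc).sub_const
    (logGammaRatioError c x)).abs
  rw [zero_sub, abs_neg] at hlim
  refine le_of_tendsto' hlim fun n => (bound (n + 1)).trans (sub_le_self _ (by positivity))

lemma Gamma_add_div_Gamma_eq {c x : ℝ} (hx : 0 < x) (hxc : 0 < x + c) :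
    Gamma (x + c) / Gamma x =
      x ^ c * exp (logGammaRatioError c x - c * (1 - c) / 2 / x) := by
  rw [rpow_def_of_pos hx, ← exp_add, logGammaRatioError,
    ← exp_log (div_pos (Gamma_pos_of_pos hxc) (Gamma_pos_of_pos hx)),
    log_div (Gamma_pos_of_pos hxc).ne' (Gamma_pos_of_pos hx).ne']
  congr 1
  ring

/-- For every real `c`, as `x → ∞`,
`Γ(x+c)/Γ(x) = x^c · (1 − c(1−c)/(2x) + O(x^{−2}))`, i.e.
`Γ(x+c)/Γ(x) − x^c + (c(1−c)/2)·x^{c−1} = O(x^{c−2})`. -/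
theorem gamma_ratio_asymptotic (c : ℝ) :
    (fun x : ℝ => Real.Gamma (x + c) / Real.Gamma x - x ^ c
        + (c * (1 - c) / 2) * x ^ (c - 1))
      =O[atTop] (fun x : ℝ => x ^ (c - 2)) := by
  set a := c * (1 - c) / 2 with ha
  set K := 2 * |c| ^ 3 + 2 * |c| + |a| with hK
  have hK0 : 0 ≤ K := by positivity
  have ha0 := abs_nonneg a
  refine IsBigO.of_bound ((K + |a|) ^ 2 + K) ?_
  filter_upwards [eventually_ge_atTop (2 * |c| + 2 + (K + |a|))] with x hx
  have hc := abs_nonneg c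
  have hx0 : 0 < x := by linarith
  have hxc : 0 < x + c := by linarith [neg_abs_le c]
  have hE : |logGammaRatioError c x| ≤ K / x ^ 2 := abs_logGammaRatioError_le (by linarith)
  have hu : |logGammaRatioError c x - a / x| ≤ (K + |a|) / x := by
    refine (abs_sub _ _).trans ?_
    rw [abs_div, abs_of_pos hx0, add_div]
    gcongr
    refine hE.trans ?_
    gcongr
    nlinarith
  have hexp := abs_exp_sub_one_sub_id_le (hu.trans (by rw [div_le_one hx0]; linarith))
  have hsq : (logGammaRatioError c x - a / x) ^ 2 ≤ (K + |a|) ^ 2 / x ^ 2 := by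
    rw [← sq_abs, ← div_pow]
    gcongr
  rw [Gamma_add_div_Gamma_eq hx0 hxc, ← ha, rpow_sub_one hx0.ne', rpow_sub hx0, rpow_two]
  have e : x ^ c * exp (logGammaRatioError c x - a / x) - x ^ c + a * (x ^ c / x) =
      x ^ c * ((exp (logGammaRatioError c x - a / x) - 1 - (logGammaRatioError c x - a / x))
        + logGammaRatioError c x) := by
    ring
  have hpow : 0 < x ^ c := rpow_pos_of_pos hx0 c
  rw [e, norm_mul, norm_div, norm_of_nonneg hpow.le, norm_of_nonneg (sq_nonneg x), norm_eq_abs]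
  calc _ ≤ x ^ c * ((K + |a|) ^ 2 / x ^ 2 + K / x ^ 2) := by
        gcongr
        exact (abs_add_le _ _).trans (add_le_add (hexp.trans hsq) hE)
    _ = _ := by ring
end

section
/- Let a > 0 and b > −1 be real numbers. For every real x > 0, (1/Γ(b)) · ∫₀¹ (1 − u^x) · u^{a−1} · (1−u)^{b−1} du = Γ(a)/Γ(a+b) − Γ(x+a)/Γ(x+a+b). (The integral converges for b > −1 because 1 − u^x vanishes linearly at u = 1; for b ∈ (−1, 0) the factor 1/Γ(b) uses the analytically continued Gamma function, and for b = 0 both sides equal 0.) -/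
open Real MeasureTheory

open Filter Set Topology intervalIntegral

lemma intervalIntegrable_beta {s t : ℝ} (hs : 0 < s) (ht : 0 < t) :
    IntervalIntegrable (fun u : ℝ ↦ u ^ (s - 1) * (1 - u) ^ (t - 1)) volume 0 1 := by
  have h := Complex.betaIntegral_convergent (u := s) (v := t) (by simpa) (by simpa)
  rw [intervalIntegrable_iff_integrableOn_Ioc_of_le zero_le_one] at h ⊢
  refine IntegrableOn.congr_fun (Integrable.re h) (fun u hu ↦ ?_) measurableSet_Ioc
  have h1 : (u : ℂ) ^ ((s : ℂ) - 1) = ((u ^ (s - 1) : ℝ) : ℂ) := by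
    rw [Complex.ofReal_cpow hu.1.le]; push_cast; rfl
  have h2 : (1 - (u : ℂ)) ^ ((t : ℂ) - 1) = (((1 - u) ^ (t - 1) : ℝ) : ℂ) := by
    rw [Complex.ofReal_cpow (sub_nonneg.2 hu.2)]; push_cast; rfl
  simp only [h1, h2, ← Complex.ofReal_mul, RCLike.re_to_complex, Complex.ofReal_re]

lemma integral_beta {s t : ℝ} (hs : 0 < s) (ht : 0 < t) :
    ∫ u in (0 : ℝ)..1, u ^ (s - 1) * (1 - u) ^ (t - 1)
      = Real.Gamma s * Real.Gamma t / Real.Gamma (s + t) := by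
  have h := Complex.betaIntegral_eq_Gamma_mul_div s t (by simpa) (by simpa)
  have key : Complex.betaIntegral s t
      = ((∫ u in (0 : ℝ)..1, u ^ (s - 1) * (1 - u) ^ (t - 1) : ℝ) : ℂ) := by
    rw [← intervalIntegral.integral_ofReal, Complex.betaIntegral]
    refine intervalIntegral.integral_congr fun u hu ↦ ?_
    rw [uIcc_of_le zero_le_one] at hu
    simp only [Complex.ofReal_mul]
    rw [Complex.ofReal_cpow hu.1, Complex.ofReal_cpow (sub_nonneg.2 hu.2)]
    push_cast
    rfl
  rw [key, ← Complex.ofReal_add] at h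
  simp only [Complex.Gamma_ofReal] at h
  exact_mod_cast h

lemma one_sub_rpow_le {x u : ℝ} (hu : u ∈ Icc (0 : ℝ) 1) :
    1 - u ^ x ≤ max 1 x * (1 - u) := by
  have h := one_add_mul_self_le_rpow_one_add (s := u - 1) (by linarith [hu.1]) (le_max_left 1 x)
  rw [add_sub_cancel] at h
  rcases hu.1.eq_or_lt with rfl | h0
  · have : (0 : ℝ) ≤ 0 ^ x := Real.rpow_nonneg le_rfl x
    linarith [le_max_left 1 x]
  · linarith [Real.rpow_le_rpow_of_exponent_ge h0 hu.2 (le_max_right 1 x)]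

lemma intervalIntegrable_one_sub_rpow_mul_beta {a b x : ℝ} (ha : 0 < a) (hb : -1 < b)
    (hx : 0 < x) :
    IntervalIntegrable (fun u : ℝ ↦ (1 - u ^ x) * u ^ (a - 1) * (1 - u) ^ (b - 1))
      volume 0 1 := by
  have h := (intervalIntegrable_beta ha (by linarith : 0 < b + 1)).const_mul (max 1 x)
  refine h.mono_fun' (by fun_prop) ?_
  rw [uIoc_of_le zero_le_one, ← restrict_Ioo_eq_restrict_Ioc]
  refine ae_restrict_of_forall_mem measurableSet_Ioo fun u hu ↦ ?_
  have h0 : 0 ≤ 1 - u ^ x := sub_nonneg.2 (Real.rpow_le_one hu.1.le hu.2.le hx.le)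
  have h1 : 0 < 1 - u := sub_pos.2 hu.2
  have hu0 := hu.1
  beta_reduce
  rw [Real.norm_of_nonneg (by positivity), add_sub_cancel_right]
  calc (1 - u ^ x) * u ^ (a - 1) * (1 - u) ^ (b - 1)
      ≤ (max 1 x * (1 - u)) * u ^ (a - 1) * (1 - u) ^ (b - 1) := by
        gcongr; exact one_sub_rpow_le (Ioo_subset_Icc_self hu)
    _ = max 1 x * (u ^ (a - 1) * (1 - u) ^ b) := by
        rw [Real.rpow_sub_one h1.ne' b]; field_simp

lemma tendsto_one_sub_rpow_mul_beta_zero {a b x : ℝ} (ha : 0 < a) (hx : 0 < x) :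
    Tendsto (fun u : ℝ ↦ (1 - u ^ x) * u ^ a * (1 - u) ^ b) (𝓝[>] 0) (𝓝 0) := by
  have h : ContinuousAt (fun u : ℝ ↦ (1 - u ^ x) * u ^ a * (1 - u) ^ b) 0 := by
    refine ((continuousAt_const.sub (continuousAt_id.rpow_const (Or.inr hx.le))).mul
      (continuousAt_id.rpow_const (Or.inr ha.le))).mul
      ((continuousAt_const.sub continuousAt_id).rpow_const (Or.inl ?_))
    simp
  simpa [ContinuousAt, Real.zero_rpow ha.ne'] using h.tendsto.mono_left nhdsWithin_le_nhds

lemma tendsto_one_sub_rpow_mul_beta_one {a b x : ℝ} (hb : -1 < b) (hx : 0 < x) :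
    Tendsto (fun u : ℝ ↦ (1 - u ^ x) * u ^ a * (1 - u) ^ b) (𝓝[<] 1) (𝓝 0) := by
  have hb' : 0 < b + 1 := by linarith
  have h : ContinuousAt (fun u : ℝ ↦ max 1 x * (u ^ a * (1 - u) ^ (b + 1))) 1 := by
    refine continuousAt_const.mul ((continuousAt_id.rpow_const (Or.inl ?_)).mul
      ((continuousAt_const.sub continuousAt_id).rpow_const (Or.inr hb'.le)))
    simp
  have h' : Tendsto (fun u : ℝ ↦ max 1 x * (u ^ a * (1 - u) ^ (b + 1))) (𝓝[<] 1) (𝓝 0) := by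
    simpa [Real.zero_rpow hb'.ne'] using h.tendsto.mono_left (nhdsWithin_le_nhds (s := Iio 1))
  have hmem : ∀ᶠ u : ℝ in 𝓝[<] 1, u ∈ Ioo (0 : ℝ) 1 := Ioo_mem_nhdsLT zero_lt_one
  refine squeeze_zero' ?_ ?_ h'
  · filter_upwards [hmem] with u hu
    have h0 : 0 ≤ 1 - u ^ x := sub_nonneg.2 (Real.rpow_le_one hu.1.le hu.2.le hx.le)
    have h1 : 0 < 1 - u := sub_pos.2 hu.2
    have hu0 := hu.1
    positivity
  · filter_upwards [hmem] with u hu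
    have h1 : 0 < 1 - u := sub_pos.2 hu.2
    have hu0 := hu.1
    calc (1 - u ^ x) * u ^ a * (1 - u) ^ b
        ≤ (max 1 x * (1 - u)) * u ^ a * (1 - u) ^ b := by
          gcongr; exact one_sub_rpow_le (Ioo_subset_Icc_self hu)
      _ = max 1 x * (u ^ a * (1 - u) ^ (b + 1)) := by
          rw [Real.rpow_add_one h1.ne' b]; ring

lemma hasDerivAt_one_sub_rpow_mul_beta {a b x u : ℝ} (hu : u ∈ Ioo (0 : ℝ) 1) :
    HasDerivAt (fun u : ℝ ↦ (1 - u ^ x) * u ^ a * (1 - u) ^ b)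
      ((a + b) * (u ^ (a - 1) * (1 - u) ^ (b + 1 - 1))
        - (x + a + b) * (u ^ (x + a - 1) * (1 - u) ^ (b + 1 - 1))
        - b * ((1 - u ^ x) * u ^ (a - 1) * (1 - u) ^ (b - 1))) u := by
  have hu0 := hu.1
  have h1 : 0 < 1 - u := sub_pos.2 hu.2
  have hd := (((Real.hasDerivAt_rpow_const (p := x) (Or.inl hu0.ne')).const_sub 1).mul
    (Real.hasDerivAt_rpow_const (p := a) (Or.inl hu0.ne'))).mul
    (((hasDerivAt_id u).const_sub 1).rpow_const (p := b) (Or.inl h1.ne'))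
  refine hd.congr_deriv ?_
  simp only [id, Pi.mul_apply, add_sub_cancel_right]
  rw [Real.rpow_sub_one hu0.ne' (x + a), Real.rpow_add hu0, Real.rpow_sub_one hu0.ne' x,
    Real.rpow_sub_one hu0.ne' a, Real.rpow_sub_one h1.ne' b]
  field_simp
  ring

lemma mul_integral_one_sub_rpow_mul_beta {a b x : ℝ} (ha : 0 < a) (hb : -1 < b) (hx : 0 < x) :
    b * ∫ u in (0 : ℝ)..1, (1 - u ^ x) * u ^ (a - 1) * (1 - u) ^ (b - 1)
      = (a + b) * (Real.Gamma a * Real.Gamma (b + 1) / Real.Gamma (a + (b + 1)))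
        - (x + a + b) *
          (Real.Gamma (x + a) * Real.Gamma (b + 1) / Real.Gamma (x + a + (b + 1))) := by
  have hb' : 0 < b + 1 := by linarith
  have hxa : 0 < x + a := by linarith
  have i1 := (intervalIntegrable_beta ha hb').const_mul (a + b)
  have i2 := (intervalIntegrable_beta hxa hb').const_mul (x + a + b)
  have i3 := (intervalIntegrable_one_sub_rpow_mul_beta ha hb hx).const_mul b
  have h := integral_eq_sub_of_hasDerivAt_of_tendsto zero_lt_one
    (fun u hu ↦ hasDerivAt_one_sub_rpow_mul_beta (a := a) (b := b) (x := x) hu)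
    ((i1.sub i2).sub i3) (tendsto_one_sub_rpow_mul_beta_zero ha hx)
    (tendsto_one_sub_rpow_mul_beta_one hb hx)
  rw [intervalIntegral.integral_sub (i1.sub i2) i3, intervalIntegral.integral_sub i1 i2,
    intervalIntegral.integral_const_mul, intervalIntegral.integral_const_mul,
    intervalIntegral.integral_const_mul, integral_beta ha hb', integral_beta hxa hb'] at h
  linarith

lemma self_div_Gamma_add_one (s : ℝ) : s / Real.Gamma (s + 1) = 1 / Real.Gamma s := by
  rcases eq_or_ne s 0 with rfl | hs
  · simp
  · rw [Real.Gamma_add_one hs, div_mul_eq_div_div, div_self hs]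

/-- For `a > 0`, `b > −1` and every real `x > 0`,
`(1/Γ(b)) · ∫₀¹ (1 − u^x) u^{a−1} (1−u)^{b−1} du = Γ(a)/Γ(a+b) − Γ(x+a)/Γ(x+a+b)`. -/
theorem beta_like_integral_eq (a b : ℝ) (ha : 0 < a) (hb : -1 < b) (x : ℝ) (hx : 0 < x) :
    (1 / Real.Gamma b) *
        ∫ u in (0:ℝ)..1, (1 - u ^ x) * u ^ (a - 1) * (1 - u) ^ (b - 1)
      = Real.Gamma a / Real.Gamma (a + b) - Real.Gamma (x + a) / Real.Gamma (x + a + b) := by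
  rcases eq_or_ne b 0 with rfl | hb0
  · simp [div_self (Real.Gamma_pos_of_pos ha).ne',
      div_self (Real.Gamma_pos_of_pos (add_pos hx ha)).ne']
  have hG : Real.Gamma (b + 1) ≠ 0 := (Real.Gamma_pos_of_pos (by linarith)).ne'
  have h := mul_integral_one_sub_rpow_mul_beta ha hb hx
  rw [← add_assoc, ← add_assoc] at h
  calc _ = (b * ∫ u in (0:ℝ)..1, (1 - u ^ x) * u ^ (a - 1) * (1 - u) ^ (b - 1))
        / Real.Gamma (b + 1) := by
        rw [← self_div_Gamma_add_one b]; ring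
    _ = Real.Gamma a * ((a + b) / Real.Gamma (a + b + 1))
        - Real.Gamma (x + a) * ((x + a + b) / Real.Gamma (x + a + b + 1)) := by
        rw [h]; field_simp
    _ = _ := by
        rw [self_div_Gamma_add_one, self_div_Gamma_add_one]; ring
end

section
/- Let a and b be real numbers. As x → ∞ (x real), Γ(x+a)/Γ(x+a+b) = x^{−b} − b·(a + b/2 − 1/2)·x^{−b−1} + O(x^{−b−2}). -/
open Filter Asymptotics Real

open scoped Topology

/-- A function which tends to `0` along integer translates and whose unit forward difference is
`O(x⁻³)` is itself `O(x⁻²)`. -/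
lemma isBigO_inv_sq_of_forward_sub_isBigO {h : ℝ → ℝ}
    (hd : (fun x => h (x + 1) - h x) =O[atTop] (fun x : ℝ => (x ^ 3)⁻¹))
    (hl : ∀ᶠ x in atTop, Tendsto (fun n : ℕ => h (x + n)) atTop (𝓝 0)) :
    h =O[atTop] (fun x : ℝ => (x ^ 2)⁻¹) := by
  obtain ⟨C, hC0, hC⟩ := hd.exists_pos
  obtain ⟨N, hN⟩ := eventually_atTop.1 hC.bound
  have step : ∀ x : ℝ, 2 ≤ x → N ≤ x →
      |h (x + 1) - h x| ≤ C * (x ^ 2)⁻¹ - C * ((x + 1) ^ 2)⁻¹ := by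
    intro x hx hNx
    have h1 := hN x hNx
    rw [Real.norm_eq_abs, Real.norm_of_nonneg (by positivity)] at h1
    have h2 : (x ^ 3)⁻¹ ≤ (x ^ 2)⁻¹ - ((x + 1) ^ 2)⁻¹ := by
      have : (x ^ 2)⁻¹ - ((x + 1) ^ 2)⁻¹ - (x ^ 3)⁻¹
          = (x ^ 2 - x - 1) / (x ^ 3 * (x + 1) ^ 2) := by
        field_simp
        ring
      have : 0 ≤ (x ^ 2 - x - 1) / (x ^ 3 * (x + 1) ^ 2) :=
        div_nonneg (by nlinarith) (by positivity)
      linarith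
    nlinarith
  refine IsBigO.of_bound C ?_
  filter_upwards [hl, eventually_ge_atTop 2, eventually_ge_atTop N] with x hx hx2 hxN
  rw [Real.norm_eq_abs, Real.norm_of_nonneg (by positivity)]
  have hinv : Tendsto (fun n : ℕ => C * ((x + n) ^ 2)⁻¹) atTop (𝓝 0) := by
    have : Tendsto (fun n : ℕ => (x + n) ^ 2) atTop atTop :=
      (tendsto_pow_atTop two_ne_zero).comp
        (tendsto_atTop_add_const_left _ x tendsto_natCast_atTop_atTop)
    simpa using this.inv_tendsto_atTop.const_mul C
  have stepn (n : ℕ) := abs_le.1 <| step (x + n) (by linarith [n.cast_nonneg (α := ℝ)])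
    (by linarith [n.cast_nonneg (α := ℝ)])
  have upper : Antitone fun n : ℕ => C * ((x + n) ^ 2)⁻¹ + h (x + n) := by
    refine antitone_nat_of_succ_le fun n => ?_
    push_cast
    rw [← add_assoc]
    linarith [(stepn n).2]
  have lower : Antitone fun n : ℕ => C * ((x + n) ^ 2)⁻¹ - h (x + n) := by
    refine antitone_nat_of_succ_le fun n => ?_
    push_cast
    rw [← add_assoc]
    linarith [(stepn n).1]
  have hu := upper.le_of_tendsto (hinv.add hx) 0
  have hlow := lower.le_of_tendsto (hinv.sub hx) 0
  simp only [Nat.cast_zero, add_zero, sub_zero] at hu hlow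
  exact abs_le.2 ⟨by linarith, by linarith⟩

lemma log_add_sub_log_isBigO (a : ℝ) :
    (fun x : ℝ => log (x + a) - log x - a / x + a ^ 2 / (2 * x ^ 2))
      =O[atTop] (fun x : ℝ => (x ^ 3)⁻¹) := by
  refine IsBigO.of_bound (2 * |a| ^ 3) ?_
  filter_upwards [eventually_ge_atTop (2 * |a| + 1)] with x hx
  have hx0 : 0 < x := by linarith [abs_nonneg a]
  have habs : |-a / x| = |a| / x := by rw [abs_div, abs_neg, abs_of_pos hx0]
  have hhalf : |a| / x ≤ 1 / 2 := by
    rw [div_le_iff₀ hx0]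
    linarith
  have key := Real.abs_log_sub_add_sum_range_le (x := -a / x) (by rw [habs]; linarith) 2
  rw [habs] at key
  have hlog : log (1 - -a / x) = log (x + a) - log x := by
    rw [← log_div (by linarith [neg_abs_le a, abs_nonneg a]) hx0.ne']
    congr 1
    field_simp
    ring
  rw [hlog] at key
  have hsum : ∑ i ∈ Finset.range 2, (-a / x) ^ (i + 1) / ((i : ℝ) + 1)
      + (log (x + a) - log x) = log (x + a) - log x - a / x + a ^ 2 / (2 * x ^ 2) := by
    simp only [Finset.sum_range_succ, Finset.sum_range_zero]
    push_cast
    field_simp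
    ring
  rw [hsum] at key
  rw [Real.norm_eq_abs, Real.norm_of_nonneg (by positivity)]
  refine key.trans ?_
  rw [div_le_iff₀ (by linarith)]
  have : 2 * |a| ^ 3 * (x ^ 3)⁻¹ = 2 * (|a| / x) ^ 3 := by
    field_simp
  rw [this]
  have h3 : 0 ≤ (|a| / x) ^ 3 := by positivity
  norm_num
  nlinarith

lemma tendsto_log_Gamma_add_nat {s : ℝ} (hs : 0 < s) :
    Tendsto (fun n : ℕ => log (Gamma (s + (n + 1 : ℕ))) - s * log n - log n.factorial)
      atTop (𝓝 0) := by
  have h1 := (tendsto_const_nhds (x := log (Gamma s))).sub (BohrMollerup.tendsto_log_gamma hs)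
  rw [sub_self] at h1
  refine h1.congr fun n => ?_
  have h2 := BohrMollerup.f_add_nat_eq (f := log ∘ Gamma) (fun {y} hy => by
    simp only [Function.comp_apply]
    rw [Gamma_add_one hy.ne', log_mul hy.ne' (Gamma_pos_of_pos hy).ne', add_comm]) hs (n + 1)
  simp only [Function.comp_apply] at h2
  rw [h2, BohrMollerup.logGammaSeq]
  ring

/-- The correction `log (Γ(x+a)/Γ(x+a+b)) + b log x` tends to `0` along integer translates. -/
lemma tendsto_log_Gamma_sub_log_Gamma_add_nat {a b x : ℝ} (ha : 0 < x + a)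
    (hab : 0 < x + a + b) :
    Tendsto (fun n : ℕ => log (Gamma (x + n + a)) - log (Gamma (x + n + a + b))
      + b * log (x + n)) atTop (𝓝 0) := by
  rw [← tendsto_add_atTop_iff_nat 1]
  have hlog : Tendsto (fun n : ℕ => log (n + (x + 1)) - log n) atTop (𝓝 0) :=
    (tendsto_log_comp_add_sub_log (x + 1)).comp tendsto_natCast_atTop_atTop
  have h := ((tendsto_log_Gamma_add_nat ha).sub (tendsto_log_Gamma_add_nat hab)).add
    (hlog.const_mul b)
  simp only [sub_self, mul_zero, add_zero] at h
  refine h.congr fun n => ?_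
  push_cast
  rw [show x + a + ((n : ℝ) + 1) = x + (n + 1) + a by ring,
    show x + a + b + ((n : ℝ) + 1) = x + (n + 1) + a + b by ring,
    show (n : ℝ) + (x + 1) = x + (n + 1) by ring]
  ring

lemma log_Gamma_sub_log_Gamma_isBigO (a b : ℝ) :
    (fun x : ℝ => log (Gamma (x + a)) - log (Gamma (x + a + b)) + b * log x
        + b * (a + b / 2 - 1 / 2) / x)
      =O[atTop] (fun x : ℝ => (x ^ 2)⁻¹) := by
  set c := b * (a + b / 2 - 1 / 2) with hc
  refine isBigO_inv_sq_of_forward_sub_isBigO ?_ ?_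
  · have hrec : (fun x : ℝ => c / (x ^ 2 * (x + 1))) =O[atTop] (fun x : ℝ => (x ^ 3)⁻¹) := by
      refine IsBigO.of_bound |c| ?_
      filter_upwards [eventually_gt_atTop 0] with x hx
      rw [norm_div, Real.norm_eq_abs, Real.norm_of_nonneg (by positivity),
        Real.norm_of_nonneg (by positivity), div_eq_mul_inv]
      gcongr
      nlinarith [pow_pos hx 2]
    refine ((((log_add_sub_log_isBigO a).sub (log_add_sub_log_isBigO (a + b))).add
      ((log_add_sub_log_isBigO 1).const_mul_left b)).add hrec).congr' ?_ .rfl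
    filter_upwards [eventually_gt_atTop 0, eventually_gt_atTop (-a),
      eventually_gt_atTop (-(a + b))] with x hx ha hab
    have ha' : 0 < x + a := by linarith
    have hab' : 0 < x + a + b := by linarith
    rw [show x + 1 + a + b = x + a + b + 1 by ring, show x + 1 + a = x + a + 1 by ring,
      Gamma_add_one ha'.ne', Gamma_add_one hab'.ne',
      log_mul ha'.ne' (Gamma_pos_of_pos ha').ne', log_mul hab'.ne' (Gamma_pos_of_pos hab').ne',
      ← add_assoc, hc]
    field_simp
    ring
  · filter_upwards [eventually_gt_atTop (-a), eventually_gt_atTop (-(a + b))] with x ha hab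
    have hinv : Tendsto (fun n : ℕ => c / (x + n)) atTop (𝓝 0) :=
      (tendsto_atTop_add_const_left _ x tendsto_natCast_atTop_atTop).const_div_atTop c
    simpa using (tendsto_log_Gamma_sub_log_Gamma_add_nat (a := a) (b := b) (by linarith)
      (by linarith)).add hinv

lemma exp_sub_one_add_div_isBigO {F : ℝ → ℝ} {c : ℝ}
    (hF : (fun x => F x + c / x) =O[atTop] (fun x : ℝ => (x ^ 2)⁻¹)) :
    (fun x => exp (F x) - 1 + c / x) =O[atTop] (fun x : ℝ => (x ^ 2)⁻¹) := by
  have hsq : (fun x : ℝ => (x ^ 2)⁻¹) =O[atTop] (fun x : ℝ => x⁻¹) := by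
    refine IsBigO.of_bound 1 ?_
    filter_upwards [eventually_ge_atTop 1] with x hx
    rw [Real.norm_of_nonneg (by positivity), Real.norm_of_nonneg (by positivity), one_mul]
    gcongr
    nlinarith
  have hF1 : F =O[atTop] (fun x : ℝ => x⁻¹) := by
    have h1 : (fun x : ℝ => c / x) =O[atTop] (fun x : ℝ => x⁻¹) := by
      simpa only [div_eq_mul_inv] using (isBigO_refl (fun x : ℝ => x⁻¹) atTop).const_mul_left c
    simpa using (hF.trans hsq).sub h1
  have hF0 : Tendsto F atTop (𝓝 0) := hF1.trans_tendsto tendsto_inv_atTop_zero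
  have hexp : (fun x => exp (F x) - 1 - F x) =O[atTop] (fun x : ℝ => (x ^ 2)⁻¹) := by
    have h1 : (fun x => exp (F x) - 1 - F x) =O[atTop] (fun x => F x ^ 2) := by
      refine IsBigO.of_bound 1 ?_
      filter_upwards [hF0.eventually (Metric.closedBall_mem_nhds 0 one_pos)] with x hx
      rw [dist_zero_right, Real.norm_eq_abs] at hx
      simpa using Real.abs_exp_sub_one_sub_id_le hx
    simpa only [inv_pow] using h1.trans (hF1.pow 2)
  refine (hexp.add hF).congr_left fun x => ?_
  ring

/-- For all reals `a, b`, as `x → ∞`,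
`Γ(x+a)/Γ(x+a+b) = x^{−b} − b·(a + b/2 − 1/2)·x^{−b−1} + O(x^{−b−2})`. -/
theorem gamma_ratio_shift_asymptotic (a b : ℝ) :
    (fun x : ℝ => Real.Gamma (x + a) / Real.Gamma (x + a + b) - x ^ (-b)
        + b * (a + b / 2 - 1 / 2) * x ^ (-b - 1))
      =O[atTop] (fun x : ℝ => x ^ (-b - 2)) := by
  refine ((isBigO_refl (fun x : ℝ => x ^ (-b)) atTop).mul
    (exp_sub_one_add_div_isBigO (log_Gamma_sub_log_Gamma_isBigO a b))).congr' ?_ ?_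
  · filter_upwards [eventually_gt_atTop 0, eventually_gt_atTop (-a),
      eventually_gt_atTop (-(a + b))] with x hx ha hab
    have hexp : x ^ (-b) * exp (log (Gamma (x + a)) - log (Gamma (x + a + b)) + b * log x)
        = Gamma (x + a) / Gamma (x + a + b) := by
      rw [rpow_def_of_pos hx, ← exp_add,
        ← exp_log (Gamma_pos_of_pos (show 0 < x + a by linarith)),
        ← exp_log (Gamma_pos_of_pos (show 0 < x + a + b by linarith)), ← exp_sub]
      simp only [log_exp]
      congr 1
      ring
    rw [← hexp, rpow_sub_one hx.ne']
    ring
  · filter_upwards [eventually_gt_atTop 0] with x hx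
    rw [rpow_sub hx, rpow_two, div_eq_mul_inv]
end

section
/- Let γ ∈ [0,1), let k ≥ 1 be an integer, let 1/2 < γ₁ < γ₂ < … < γ_{k−1} < γ_k = 1 be real exponents, let c₁, …, c_k ∈ ℝ and ε > 0. Let φ:(0,∞)→(0,∞) be increasing, with x ↦ x/φ(x) strictly increasing with range an interval (x_ψ,∞), and suppose that φ(x) = x^γ · (1 − Σ_{i=1}^k c_i·x^{−γ_i} + O(x^{−1−ε})) as x → ∞. Then there exists η > 0 such that ψ(x)/x = x^{γ/(1−γ)} · (1 − Σ_{i=1}^k c_i/((1−γ)·x^{γ_i/(1−γ)})) + O(x^{−1−η}) as x → ∞. -/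
open Filter Asymptotics Real

theorem isBigO_one_sub_rpow_sub_one (p : ℝ) :
    (fun t : ℝ => (1 - t) ^ p - 1) =O[nhds 0] (fun t : ℝ => t) := by
  have h : DifferentiableAt ℝ (fun t : ℝ => (1 - t) ^ p) 0 :=
    ((differentiableAt_const _).sub differentiableAt_id).rpow_const (Or.inl (by norm_num))
  simpa using h.isBigO_sub

theorem isBigO_one_sub_rpow_sub_linear (p : ℝ) :
    (fun t : ℝ => (1 - t) ^ p - (1 - p * t)) =O[nhds 0] (fun t : ℝ => t ^ 2) := by
  have h := (one_add_rpow_hasFPowerSeriesAt_zero (a := p)).isBigO_sub_partialSum_pow 2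
  have hneg : Tendsto (fun t : ℝ => -t) (nhds 0) (nhds 0) := by
    simpa using (continuous_neg.tendsto (0 : ℝ))
  refine (h.comp_tendsto hneg).congr (fun t => ?_) (fun t => by simp)
  simp [FormalMultilinearSeries.partialSum, Finset.sum_range_succ, binomialSeries,
    FormalMultilinearSeries.ofScalars]
  ring_nf

theorem isBigO_rpow_neg_of_le {p q : ℝ} (h : p ≤ q) :
    (fun x : ℝ => x ^ (-q)) =O[atTop] (fun x : ℝ => x ^ (-p)) := by
  refine IsBigO.of_bound 1 ?_
  filter_upwards [eventually_ge_atTop 1] with x hx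
  rw [norm_of_nonneg (by positivity), norm_of_nonneg (by positivity), one_mul]
  exact rpow_le_rpow_of_exponent_le hx (by linarith)

theorem tendsto_atTop_of_div_eq {φ ψ : ℝ → ℝ} {y₀ : ℝ}
    (hratio : StrictMonoOn (fun x => x / φ x) (Set.Ioi 0))
    (hψpos : ∀ y > y₀, 0 < ψ y) (hψinv : ∀ y > y₀, ψ y / φ (ψ y) = y) :
    Tendsto ψ atTop atTop := by
  refine tendsto_atTop.2 fun b => ?_
  set M := max b 1
  have hM : 0 < M := lt_max_of_lt_right one_pos
  filter_upwards [eventually_gt_atTop y₀, eventually_gt_atTop (M / φ M)] with y hy hyM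
  by_contra! hlt
  have := hratio.monotoneOn (hψpos y hy) hM (hlt.le.trans (le_max_left _ _))
  simp only [hψinv y hy] at this
  linarith

theorem isBigO_bracket {ι : Type*} [Fintype ι] {t : ℝ → ℝ} {r c : ι → ℝ} {a g δ m : ℝ}
    (ha : 1 + a * g = a) (hm : 0 < m) (hmr : ∀ i, m ≤ r i) (hδ : 1 + δ ≤ 2 * m)
    (hmδ : m ≤ 1 + δ)
    (ht : (fun x => t x - ∑ i, c i * x ^ (-(r i))) =O[atTop] fun x : ℝ => x ^ (-(1 + δ))) :
    Tendsto t atTop (nhds 0) ∧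
    (fun x => (1 - t x) - (1 - t x) ^ (-(a * g))
        + a * ∑ i, c i * (x ^ (-(r i)) * (1 - t x) ^ (-(a * g) + a * r i)))
      =O[atTop] fun x : ℝ => x ^ (-(1 + δ)) := by
  have hsum : (fun x : ℝ => ∑ i, c i * x ^ (-(r i))) =O[atTop] fun x : ℝ => x ^ (-m) :=
    IsBigO.fun_sum fun i _ => (isBigO_rpow_neg_of_le (hmr i)).const_mul_left _
  have htm : t =O[atTop] fun x : ℝ => x ^ (-m) := by
    simpa using (ht.trans (isBigO_rpow_neg_of_le hmδ)).add hsum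
  have ht0 : Tendsto t atTop (nhds 0) := htm.trans_tendsto (tendsto_rpow_neg_atTop hm)
  have hprod : (fun x : ℝ => x ^ (-m) * x ^ (-m)) =O[atTop] fun x : ℝ => x ^ (-(1 + δ)) := by
    refine (isBigO_rpow_neg_of_le hδ).congr' ?_ EventuallyEq.rfl
    filter_upwards [eventually_gt_atTop 0] with x hx
    rw [← rpow_add hx]
    ring_nf
  have hquad : (fun x => (1 - t x) ^ (-(a * g)) - (1 - -(a * g) * t x))
      =O[atTop] fun x : ℝ => x ^ (-(1 + δ)) := by
    refine ((isBigO_one_sub_rpow_sub_linear (-(a * g))).comp_tendsto ht0).trans ?_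
    refine IsBigO.trans ?_ hprod
    simpa [Function.comp_def, sq] using htm.mul htm
  have hcross : (fun x => ∑ i, c i * (x ^ (-(r i)) * ((1 - t x) ^ (-(a * g) + a * r i) - 1)))
      =O[atTop] fun x : ℝ => x ^ (-(1 + δ)) := by
    refine IsBigO.fun_sum fun i _ => IsBigO.const_mul_left ?_ _
    refine ((isBigO_rpow_neg_of_le (hmr i)).mul ?_).trans hprod
    exact ((isBigO_one_sub_rpow_sub_one _).comp_tendsto ht0).trans htm
  refine ⟨ht0, (((hcross.const_mul_left a).sub hquad).sub (ht.const_mul_left a)).congr_left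
    fun x => ?_⟩
  simp only [mul_sub, mul_one, Finset.sum_sub_distrib]
  linear_combination t x * ha

/-- asymptotic expansion of `ψ(x)/x` where `ψ` is the inverse of `x ↦ x/φ(x)`,
given an asymptotic expansion of `φ(x) = x^γ (1 - ∑ cᵢ x^{-γᵢ} + O(x^{-1-ε}))` with
`γ ∈ [0,1)`, `1/2 < γ₁ < ⋯ < γ_k = 1`. -/
theorem psi_expansion_of_phi_expansion
    (γ : ℝ) (hγ : γ ∈ Set.Ico (0:ℝ) 1) (k : ℕ) (hk : 1 ≤ k)
    (γs c : Fin k → ℝ) (hγs : StrictMono γs) (hfirst : 1 / 2 < γs ⟨0, by omega⟩)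
    (hlast : γs ⟨k - 1, by omega⟩ = 1) (ε : ℝ) (hε : 0 < ε)
    (φ ψ : ℝ → ℝ) (xψ : ℝ)
    (hφpos : ∀ x > (0:ℝ), 0 < φ x)
    (hφmono : MonotoneOn φ (Set.Ioi 0))
    (hratio : StrictMonoOn (fun x => x / φ x) (Set.Ioi 0))
    (hrange : (fun x => x / φ x) '' Set.Ioi 0 = Set.Ioi xψ)
    (hψpos : ∀ y > xψ, 0 < ψ y)
    (hψinv : ∀ y > xψ, ψ y / φ (ψ y) = y)
    (hφexp : (fun x : ℝ => φ x - x ^ γ * (1 - ∑ i, c i * x ^ (-(γs i))))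
        =O[atTop] (fun x : ℝ => x ^ (γ - 1 - ε))) :
    ∃ η > (0:ℝ),
      (fun x : ℝ => ψ x / x
          - x ^ (γ / (1 - γ)) * (1 - ∑ i, c i / ((1 - γ) * x ^ (γs i / (1 - γ)))))
        =O[atTop] (fun x : ℝ => x ^ (-1 - η)) := by
  have hγ1 : 0 < 1 - γ := sub_pos.2 hγ.2
  set m := γs ⟨0, by omega⟩ with hm
  have hmr : ∀ i, m ≤ γs i := fun i => hγs.monotone (Fin.mk_le_of_le_val (Nat.zero_le _))
  have hm1 : m ≤ 1 := hlast ▸ hmr _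
  set δ := min ε (2 * m - 1) with hδ
  have hδ0 : 0 < δ := lt_min hε (by linarith)
  have hδε : δ ≤ ε := min_le_left _ _
  have hδm : δ ≤ 2 * m - 1 := min_le_right _ _
  set a := 1 / (1 - γ) with ha
  have haγ : 1 + a * γ = a := by rw [ha]; field_simp; ring
  have haγ' : a * (1 - γ) = 1 := by rw [ha]; field_simp
  set t : ℝ → ℝ := fun x => 1 - φ x * x ^ (-γ) with htdef
  have ht : (fun x => t x - ∑ i, c i * x ^ (-(γs i))) =O[atTop] fun x : ℝ => x ^ (-(1 + δ)) := by
    have h := (isBigO_refl (fun x : ℝ => x ^ (-γ)) atTop).mul hφexp.neg_left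
    refine IsBigO.trans (h.congr' ?_ ?_) (isBigO_rpow_neg_of_le (add_le_add_right hδε 1))
    · filter_upwards [eventually_gt_atTop 0] with x hx
      have hx1 : x ^ (-γ) * x ^ γ = 1 := by rw [← rpow_add hx]; simp
      simp only [htdef]
      linear_combination (1 - ∑ i, c i * x ^ (-(γs i))) * hx1
    · filter_upwards [eventually_gt_atTop 0] with x hx
      rw [← rpow_add hx]
      ring_nf
  obtain ⟨ht0, hB⟩ := isBigO_bracket haγ (by linarith) hmr (by linarith) (by linarith) ht
  refine ⟨a * δ, mul_pos (by positivity) hδ0, ?_⟩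
  have hψ := tendsto_atTop_of_div_eq hratio hψpos hψinv
  have hφt : ∀ x > 0, φ x = x ^ γ * (1 - t x) := fun x hx => by
    have hx1 : x ^ (-γ) * x ^ γ = 1 := by rw [← rpow_add hx]; simp
    simp only [htdef]
    linear_combination -φ x * hx1
  have htpos : ∀ x > 0, 0 < 1 - t x := fun x hx => by
    have := hφpos x hx
    simp only [htdef, sub_sub_cancel]
    positivity
  have hpow : ∀ x > 0, ∀ p : ℝ,
      (x / φ x) ^ p = x ^ ((1 - γ) * p) * (1 - t x) ^ (-p) := fun x hx p => by
    have h1 := htpos x hx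
    have h2 : x / φ x = x ^ (1 - γ) * (1 - t x)⁻¹ := by
      rw [hφt x hx, rpow_sub hx, rpow_one]
      field_simp
    rw [h2, mul_rpow (by positivity) (by positivity), ← rpow_mul hx.le, inv_rpow h1.le,
      rpow_neg h1.le]
  have hcmp : (fun x => x ^ γ * x ^ (-(1 + δ))) =O[atTop]
      fun x => (x / φ x) ^ (-1 - a * δ) := by
    have hlim : Tendsto (fun x => (1 - t x) ^ (-1 - a * δ)) atTop (nhds 1) := by
      simpa using (tendsto_const_nhds.sub ht0).rpow_const
        (p := -1 - a * δ) (Or.inl (by norm_num : (1 : ℝ) - 0 ≠ 0))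
    have h := (isBigO_refl (fun x => (x / φ x) ^ (-1 - a * δ)) atTop).mul (hlim.isBigO_one ℝ)
    refine h.congr' ?_ (by simp)
    filter_upwards [eventually_gt_atTop 0] with x hx
    rw [hpow x hx, mul_assoc, ← rpow_add (htpos x hx), ← rpow_add hx, neg_add_cancel, rpow_zero,
      mul_one]
    congr 1
    linear_combination -δ * haγ'
  have hmain := (((isBigO_refl (fun x : ℝ => x ^ γ) atTop).mul hB).trans hcmp).comp_tendsto hψ
  refine hmain.congr' ?_ ?_
  · filter_upwards [eventually_gt_atTop xψ] with y hy
    have hu := hψpos y hy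
    have hinv := hψinv y hy
    have hφu := hφpos _ hu
    have hdiv : ψ y / y = φ (ψ y) := by
      nth_rewrite 2 [← hinv]
      field_simp
    rw [hdiv]
    simp only [Function.comp_apply]
    clear hdiv
    generalize ψ y = u at *
    subst hinv
    have h1 := htpos u hu
    have hterm : ∀ i, c i / ((1 - γ) * (u / φ u) ^ (γs i / (1 - γ)))
        = a * (c i * (u ^ (-(γs i)) * (1 - t u) ^ (a * γs i))) := fun i => by
      rw [hpow u hu, mul_div_cancel₀ _ hγ1.ne', rpow_neg hu.le, rpow_neg h1.le,
        ha, one_div_mul_eq_div]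
      field_simp
    have hexp : γ / (1 - γ) = a * γ := by rw [ha, one_div_mul_eq_div]
    simp only [hterm, rpow_add h1, ← Finset.mul_sum]
    rw [hexp, hpow u hu, show (1 - γ) * (a * γ) = γ by linear_combination γ * haγ']
    have hpull : ∑ i, c i * (u ^ (-(γs i)) * ((1 - t u) ^ (-(a * γ)) * (1 - t u) ^ (a * γs i)))
        = (1 - t u) ^ (-(a * γ)) * ∑ i, c i * (u ^ (-(γs i)) * (1 - t u) ^ (a * γs i)) := by
      rw [Finset.mul_sum]
      exact Finset.sum_congr rfl fun i _ => by ring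
    rw [hpull]
    linear_combination -hφt u hu
  · filter_upwards [eventually_gt_atTop xψ] with y hy
    simp [hψinv y hy]
end

section
/- Let φ:(0,∞)→(0,∞) be differentiable and strictly increasing, with x ↦ x/φ(x) strictly increasing with range an interval (x_ψ,∞), and suppose there exist c ∈ (0,1) and x₀ > 0 such that x·φ′(x) ≤ c·φ(x) for all x ≥ x₀. Then there exist constants K₁, K₂ > 0 and y₀ > x_ψ such that φ(x) ≤ K₁·x^c for all x ≥ x₀, and ψ(y) ≤ K₂·y^{1/(1−c)} for all y ≥ y₀. -/
open Filter Asymptotics Real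

/-- If `x * f' x ≤ c * f x` on `[a, ∞)` with `a > 0`, then `f x * x ^ (-c)` is antitone there. -/
theorem antitoneOn_mul_rpow_neg_of_mul_deriv_le {f : ℝ → ℝ} {a c : ℝ} (ha : 0 < a)
    (hf : ∀ x ≥ a, DifferentiableAt ℝ f x) (hder : ∀ x ≥ a, x * deriv f x ≤ c * f x) :
    AntitoneOn (fun x => f x * x ^ (-c)) (Set.Ici a) := by
  have hd : ∀ x ≥ a, HasDerivAt (fun x => f x * x ^ (-c))
      (deriv f x * x ^ (-c) + f x * (-c * x ^ (-c - 1))) x := fun x hx =>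
    (hf x hx).hasDerivAt.mul (Real.hasDerivAt_rpow_const (Or.inl (ha.trans_le hx).ne'))
  refine antitoneOn_of_deriv_nonpos (convex_Ici a)
    (fun x hx => (hd x hx).continuousAt.continuousWithinAt)
    (fun x hx => (hd x (interior_subset hx)).differentiableAt.differentiableWithinAt)
    fun x hx => ?_
  have hxa : x ≥ a := interior_subset hx
  have hx0 : 0 < x := ha.trans_le hxa
  have hpow : x ^ (-c) = x ^ (-c - 1) * x := by
    rw [← Real.rpow_add_one hx0.ne', sub_add_cancel]
  rw [(hd x hxa).deriv, hpow]
  nlinarith [mul_nonneg (Real.rpow_pos_of_pos hx0 (-c - 1)).le (sub_nonneg.2 (hder x hxa))]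

/-- If `x ≤ y * (K * x ^ c)` with `c < 1`, then `x ≤ K ^ (1 / (1 - c)) * y ^ (1 / (1 - c))`. -/
theorem le_rpow_mul_rpow_of_le_mul_rpow {x y K c : ℝ} (hx : 0 < x) (hy : 0 ≤ y) (hK : 0 ≤ K)
    (hc : c < 1) (h : x ≤ y * (K * x ^ c)) :
    x ≤ K ^ (1 / (1 - c)) * y ^ (1 / (1 - c)) := by
  have hc' : 0 < 1 - c := sub_pos.2 hc
  rw [← Real.mul_rpow hK hy, one_div, Real.le_rpow_inv_iff_of_pos hx.le (mul_nonneg hK hy) hc',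
    Real.rpow_sub hx, Real.rpow_one, div_le_iff₀ (Real.rpow_pos_of_pos hx c)]
  linarith

/-- if `x·φ′(x) ≤ c·φ(x)` for `x ≥ x₀` with `c ∈ (0,1)`, then `φ` is bounded
above by a multiple of `x^c` on `[x₀,∞)` and the inverse `ψ` of `x ↦ x/φ(x)` is bounded
above by a multiple of `y^{1/(1−c)}` on a half-line. -/
theorem phi_psi_power_bounds
    (φ ψ : ℝ → ℝ) (xψ : ℝ)
    (hφdiff : ∀ x > (0:ℝ), DifferentiableAt ℝ φ x)
    (hφmono : StrictMonoOn φ (Set.Ioi 0))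
    (hφpos : ∀ x > (0:ℝ), 0 < φ x)
    (hratio : StrictMonoOn (fun x => x / φ x) (Set.Ioi 0))
    (hrange : (fun x => x / φ x) '' Set.Ioi 0 = Set.Ioi xψ)
    (hψpos : ∀ y > xψ, 0 < ψ y)
    (hψinv : ∀ y > xψ, ψ y / φ (ψ y) = y)
    (c x₀ : ℝ) (hc : c ∈ Set.Ioo (0:ℝ) 1) (hx₀ : 0 < x₀)
    (hder : ∀ x ≥ x₀, x * deriv φ x ≤ c * φ x) :
    ∃ K₁ > (0:ℝ), ∃ K₂ > (0:ℝ), ∃ y₀ > xψ,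
      (∀ x ≥ x₀, φ x ≤ K₁ * x ^ c) ∧ (∀ y ≥ y₀, ψ y ≤ K₂ * y ^ (1 / (1 - c))) := by
  have hanti := antitoneOn_mul_rpow_neg_of_mul_deriv_le hx₀
    (fun x hx => hφdiff x (hx₀.trans_le hx)) hder
  have hK : 0 < φ x₀ * x₀ ^ (-c) := mul_pos (hφpos x₀ hx₀) (Real.rpow_pos_of_pos hx₀ _)
  have hφle : ∀ x ≥ x₀, φ x ≤ φ x₀ * x₀ ^ (-c) * x ^ c := by
    intro x hx
    have hx0 : 0 < x := hx₀.trans_le hx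
    have h : φ x * x ^ (-c) ≤ φ x₀ * x₀ ^ (-c) := hanti Set.self_mem_Ici hx hx
    rwa [Real.rpow_neg hx0.le, ← div_eq_mul_inv, div_le_iff₀ (Real.rpow_pos_of_pos hx0 c)] at h
  have hy₀ : xψ < x₀ / φ x₀ := by
    have h : x₀ / φ x₀ ∈ (fun x => x / φ x) '' Set.Ioi 0 := ⟨x₀, hx₀, rfl⟩
    rwa [hrange] at h
  refine ⟨_, hK, _, Real.rpow_pos_of_pos hK (1 / (1 - c)), _, hy₀, hφle, fun y hy => ?_⟩
  have hyψ : y > xψ := hy₀.trans_le hy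
  have hψ0 := hψpos y hyψ
  have hinv := hψinv y hyψ
  have hy0 : 0 < y := hinv ▸ div_pos hψ0 (hφpos _ hψ0)
  have hψx : x₀ ≤ ψ y := (hratio.le_iff_le hx₀ hψ0).1 (hy.trans_eq hinv.symm)
  refine le_rpow_mul_rpow_of_le_mul_rpow hψ0 hy0.le hK.le hc.2 ?_
  calc ψ y = y * φ (ψ y) := (div_eq_iff (hφpos _ hψ0).ne').1 hinv
    _ ≤ _ := mul_le_mul_of_nonneg_left (hφle _ hψx) hy0.le
end

section
/- Let φ:(0,∞)→(0,∞) be differentiable and strictly increasing with x·φ′(x) < φ(x) for all x > 0, so that x ↦ x/φ(x) is strictly increasing; assume its range is an interval (x_ψ,∞), and let ψ:(x_ψ,∞)→(0,∞) be its inverse (which is then differentiable). If limsup_{x→∞} x·φ′(x)/φ(x) ≤ c for some c ∈ [0,1), then for every c′ ∈ (c,1) one has y·ψ′(y) ≤ ψ(y)/(1−c′) for all sufficiently large y; in particular limsup_{y→∞} y·ψ′(y)/ψ(y) ≤ 1/(1−c). -/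
open Filter Asymptotics Real

/-- If `ψ` is locally a right inverse of `x ↦ x / φ x`, then implicit differentiation gives
`y ψ'(y) (1 - ψ(y) φ'(ψ(y)) / φ(ψ(y))) = ψ(y)`. -/
theorem mul_deriv_of_div_comp_eq {φ ψ : ℝ → ℝ} {y : ℝ}
    (hφ : DifferentiableAt ℝ φ (ψ y)) (hψ : DifferentiableAt ℝ ψ y)
    (hne : φ (ψ y) ≠ 0) (hinv : ∀ᶠ z in nhds y, ψ z / φ (ψ z) = z) :
    y * deriv ψ y * (1 - ψ y * deriv φ (ψ y) / φ (ψ y)) = ψ y := by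
  have hquot : HasDerivAt (fun z => ψ z / φ (ψ z)) _ y :=
    hψ.hasDerivAt.div (hφ.hasDerivAt.comp y hψ.hasDerivAt) hne
  have hone := hquot.unique ((hasDerivAt_id y).congr_of_eventuallyEq hinv)
  have hy : y = ψ y / φ (ψ y) := hinv.self_of_nhds.symm
  rw [div_eq_one_iff_eq (pow_ne_zero 2 hne)] at hone
  calc y * deriv ψ y * (1 - ψ y * deriv φ (ψ y) / φ (ψ y))
      = ψ y / φ (ψ y) * deriv ψ y * (1 - ψ y * deriv φ (ψ y) / φ (ψ y)) := by rw [← hy]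
    _ = ψ y := by
      field_simp
      linear_combination ψ y * hone

/-- A function with logarithmic derivative less than `1 / x` grows slower than the identity. -/
theorem monotoneOn_div_of_mul_deriv_lt {φ : ℝ → ℝ}
    (hdiff : ∀ x > (0 : ℝ), DifferentiableAt ℝ φ x) (hpos : ∀ x > (0 : ℝ), 0 < φ x)
    (hder : ∀ x > (0 : ℝ), x * deriv φ x < φ x) :
    MonotoneOn (fun x => x / φ x) (Set.Ioi 0) := by
  have hquot (x : ℝ) (hx : 0 < x) :
      HasDerivAt (fun x => x / φ x) ((1 * φ x - x * deriv φ x) / φ x ^ 2) x :=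
    (hasDerivAt_id x).div (hdiff x hx).hasDerivAt (hpos x hx).ne'
  refine monotoneOn_of_deriv_nonneg (convex_Ioi 0)
    (fun x hx => (hquot x hx).continuousAt.continuousWithinAt) ?_ ?_ <;>
    rw [interior_Ioi]
  · exact fun x hx => (hquot x hx).differentiableAt.differentiableWithinAt
  · intro x hx
    rw [(hquot x hx).deriv, one_mul]
    exact div_nonneg (sub_nonneg.2 (hder x hx).le) (sq_nonneg _)

/-- A right inverse, near infinity, of a monotone function on `(0, ∞)` tends to infinity. -/
theorem tendsto_atTop_of_monotoneOn_of_rightInverse {f g : ℝ → ℝ}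
    (hf : MonotoneOn f (Set.Ioi 0)) (hg : ∀ᶠ y in atTop, 0 < g y)
    (hfg : ∀ᶠ y in atTop, f (g y) = y) : Tendsto g atTop atTop := by
  refine tendsto_atTop.2 fun M => ?_
  filter_upwards [hg, hfg, eventually_gt_atTop (f (max M 1))] with y hgy hfgy hy
  by_contra! hlt
  have hle := hf hgy (show (0 : ℝ) < max M 1 by positivity) (hlt.le.trans (le_max_left M 1))
  linarith

/-- if `limsup_{x→∞} x·φ′(x)/φ(x) ≤ c < 1`, then for every `c′ ∈ (c,1)`,
`y·ψ′(y) ≤ ψ(y)/(1−c′)` for all large `y`, and `limsup_{y→∞} y·ψ′(y)/ψ(y) ≤ 1/(1−c)`,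
where `ψ` is the (differentiable) inverse of the strictly increasing map `x ↦ x/φ(x)`. -/
theorem psi_log_derivative_limsup
    (φ ψ : ℝ → ℝ) (xψ : ℝ)
    (hφdiff : ∀ x > (0:ℝ), DifferentiableAt ℝ φ x)
    (hφmono : StrictMonoOn φ (Set.Ioi 0))
    (hφpos : ∀ x > (0:ℝ), 0 < φ x)
    (hder : ∀ x > (0:ℝ), x * deriv φ x < φ x)
    (hrange : (fun x => x / φ x) '' Set.Ioi 0 = Set.Ioi xψ)
    (hψpos : ∀ y > xψ, 0 < ψ y)
    (hψinv : ∀ y > xψ, ψ y / φ (ψ y) = y)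
    (hψdiff : ∀ y > xψ, DifferentiableAt ℝ ψ y)
    (c : ℝ) (hc : c ∈ Set.Ico (0:ℝ) 1)
    (hlimsup : Filter.limsup (fun x => x * deriv φ x / φ x) atTop ≤ c) :
    (∀ c' ∈ Set.Ioo c 1, ∀ᶠ y in atTop, y * deriv ψ y ≤ ψ y / (1 - c')) ∧
      Filter.limsup (fun y => y * deriv ψ y / ψ y) atTop ≤ 1 / (1 - c) := by
  have hφder (x : ℝ) (hx : 0 < x) : 0 ≤ deriv φ x := by
    rw [← derivWithin_of_isOpen isOpen_Ioi hx]
    exact hφmono.monotoneOn.derivWithin_nonneg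
  have hψtop : Tendsto ψ atTop atTop :=
    tendsto_atTop_of_monotoneOn_of_rightInverse
      (monotoneOn_div_of_mul_deriv_lt hφdiff hφpos hder)
      ((eventually_gt_atTop xψ).mono hψpos) ((eventually_gt_atTop xψ).mono hψinv)
  have himplicit (y : ℝ) (hy : xψ < y) :
      y * deriv ψ y * (1 - ψ y * deriv φ (ψ y) / φ (ψ y)) = ψ y :=
    mul_deriv_of_div_comp_eq (hφdiff _ (hψpos y hy)) (hψdiff y hy)
      (hφpos _ (hψpos y hy)).ne' ((eventually_gt_nhds hy).mono hψinv)
  have hfactor (x : ℝ) (hx : 0 < x) : 0 < 1 - x * deriv φ x / φ x :=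
    sub_pos.2 ((div_lt_one (hφpos x hx)).2 (hder x hx))
  have hbdd : IsBoundedUnder (· ≤ ·) atTop (fun x => x * deriv φ x / φ x) :=
    isBoundedUnder_of_eventually_le (a := 1) <| by
      filter_upwards [eventually_gt_atTop 0] with x hx
      linarith [hfactor x hx]
  have hbound : ∀ c' ∈ Set.Ioo c 1, ∀ᶠ y in atTop, y * deriv ψ y ≤ ψ y / (1 - c') := by
    intro c' hc'
    have hlt := eventually_lt_of_limsup_lt (hlimsup.trans_lt hc'.1) hbdd
    filter_upwards [eventually_gt_atTop xψ, hψtop.eventually hlt] with y hy hylt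
    rw [eq_div_of_mul_eq (hfactor _ (hψpos y hy)).ne' (himplicit y hy)]
    exact div_le_div_of_nonneg_left (hψpos y hy).le (sub_pos.2 hc'.2) (by linarith)
  refine ⟨hbound, le_of_forall_gt_imp_ge_of_dense fun r hr => ?_⟩
  have hc1 : 0 < 1 - c := sub_pos.2 hc.2
  have hr0 : 0 < r := (one_div_pos.2 hc1).trans hr
  have hrc : 1 / r < 1 - c := (one_div_lt hc1 hr0).1 hr
  have hnonneg : ∀ᶠ y in atTop, 0 ≤ y * deriv ψ y / ψ y := by
    filter_upwards [eventually_gt_atTop xψ] with y hy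
    have hψy := hψpos y hy
    rw [eq_div_of_mul_eq (hfactor _ hψy).ne' (himplicit y hy)]
    exact div_nonneg (div_nonneg hψy.le (hfactor _ hψy).le) hψy.le
  refine limsup_le_of_le (isBoundedUnder_of_eventually_ge hnonneg).isCoboundedUnder_le ?_
  filter_upwards [eventually_gt_atTop xψ,
    hbound (1 - 1 / r) ⟨by linarith, by linarith [one_div_pos.2 hr0]⟩] with y hy hle
  rw [div_le_iff₀ (hψpos y hy)]
  calc y * deriv ψ y ≤ ψ y / (1 - (1 - 1 / r)) := hle
    _ = r * ψ y := by field_simp; ring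
end

section
/- Let 0 < a ≤ b be real numbers and define, for x > 0, φ(x) := 1 − (Γ(a+b)/(Γ(a)Γ(b))) · ∫₀¹ ( u^{x+a}(1−u)^{b−1} + u^{a−1}(1−u)^{x+b} ) du (this equals 1 − E[B^{x+1}] − E[(1−B)^{x+1}] for B a Beta(a,b) random variable). Then as x → ∞, φ(x) = 1 − (Γ(a+b)/Γ(b))·x^{−a} − (Γ(a+b)/Γ(a))·x^{−b} + O(x^{−a−1}). -/
open Filter Asymptotics Real

/-- The real Beta integrand is integrable on `[0, 1]`. -/
theorem intervalIntegrable_rpow_mul_one_sub_rpow {p q : ℝ} (hp : 0 < p) (hq : 0 < q) :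
    IntervalIntegrable (fun u : ℝ => u ^ (p - 1) * (1 - u) ^ (q - 1)) MeasureTheory.volume 0 1 := by
  have h := Complex.betaIntegral_convergent (u := p) (v := q) (by simpa) (by simpa)
  rw [intervalIntegrable_iff_integrableOn_Ioc_of_le zero_le_one] at h ⊢
  refine MeasureTheory.IntegrableOn.congr_fun (MeasureTheory.Integrable.re h) (fun u hu => ?_) measurableSet_Ioc
  have h1 : (0 : ℝ) ≤ 1 - u := by linarith [hu.2]
  have key : (u : ℂ) ^ ((p : ℂ) - 1) * (1 - (u : ℂ)) ^ ((q : ℂ) - 1)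
      = ((u ^ (p - 1) * (1 - u) ^ (q - 1) : ℝ) : ℂ) := by
    rw [Complex.ofReal_mul, Complex.ofReal_cpow hu.1.le, Complex.ofReal_cpow h1]
    push_cast
    rfl
  simp only [key]
  exact Complex.ofReal_re _

/-- The real Beta integral in terms of the Gamma function. -/
theorem integral_rpow_mul_one_sub_rpow {p q : ℝ} (hp : 0 < p) (hq : 0 < q) :
    ∫ u in (0 : ℝ)..1, u ^ (p - 1) * (1 - u) ^ (q - 1)
      = Real.Gamma p * Real.Gamma q / Real.Gamma (p + q) := by
  have h := Complex.betaIntegral_eq_Gamma_mul_div p q (by simpa) (by simpa)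
  have key : Complex.betaIntegral p q
      = ((∫ u in (0 : ℝ)..1, u ^ (p - 1) * (1 - u) ^ (q - 1) : ℝ) : ℂ) := by
    rw [Complex.betaIntegral, ← intervalIntegral.integral_ofReal]
    refine intervalIntegral.integral_congr fun u hu => ?_
    rw [Set.uIcc_of_le zero_le_one] at hu
    have h1 : (0 : ℝ) ≤ 1 - u := by linarith [hu.2]
    rw [Complex.ofReal_mul, Complex.ofReal_cpow hu.1, Complex.ofReal_cpow h1]
    push_cast
    rfl
  rw [key, ← Complex.ofReal_add, Complex.Gamma_ofReal, Complex.Gamma_ofReal,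
    Complex.Gamma_ofReal] at h
  exact_mod_cast h

/-- Log-convexity bound from above: `Γ(x + c) ≤ Γ(x) x ^ c` for `0 ≤ c ≤ 1`. -/
theorem Gamma_add_le_Gamma_mul_rpow {x c : ℝ} (hx : 0 < x) (h0 : 0 ≤ c) (h1 : c ≤ 1) :
    Real.Gamma (x + c) ≤ Real.Gamma x * x ^ c := by
  rcases h0.eq_or_lt with rfl | h0
  · simp
  rcases h1.eq_or_lt with rfl | h1
  · rw [Real.Gamma_add_one hx.ne', rpow_one, mul_comm]
  have hG := Real.Gamma_pos_of_pos hx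
  have h := Real.Gamma_mul_add_mul_le_rpow_Gamma_mul_rpow_Gamma hx (add_pos hx one_pos)
    (sub_pos.2 h1) h0 (sub_add_cancel 1 c)
  rw [Real.Gamma_add_one hx.ne', mul_rpow hx.le hG.le, mul_left_comm, ← rpow_add hG,
    sub_add_cancel, rpow_one, mul_comm (x ^ c)] at h
  convert h using 2
  ring

/-- Log-convexity bound from below: `Γ(x) x ^ c ≤ Γ(x + c) (x + c) / x` for `0 ≤ c ≤ 1`. -/
theorem Gamma_mul_rpow_mul_le {x c : ℝ} (hx : 0 < x) (h0 : 0 ≤ c) (h1 : c ≤ 1) :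
    Real.Gamma x * x ^ c * x ≤ Real.Gamma (x + c) * (x + c) := by
  have hxc : 0 < x + c := by linarith
  have h := Gamma_add_le_Gamma_mul_rpow hxc (sub_nonneg.2 h1) (sub_le_self 1 h0)
  rw [show x + c + (1 - c) = x + 1 by ring, Real.Gamma_add_one hx.ne'] at h
  have hG := Real.Gamma_pos_of_pos hxc
  calc Real.Gamma x * x ^ c * x = x * Real.Gamma x * x ^ c := by ring
    _ ≤ Real.Gamma (x + c) * (x + c) ^ (1 - c) * (x + c) ^ c := by
        gcongr
        linarith
    _ = Real.Gamma (x + c) * (x + c) := by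
        rw [mul_assoc, ← rpow_add hxc, sub_add_cancel, rpow_one]

/-- `Γ(x + c) / (Γ(x) x ^ c) = 1 + O(1 / x)` as `x → ∞`, for `0 ≤ c ≤ 1`. -/
theorem isBigO_Gamma_add_div_sub_one_of_le_one {c : ℝ} (h0 : 0 ≤ c) (h1 : c ≤ 1) :
    (fun x : ℝ => Real.Gamma (x + c) / (Real.Gamma x * x ^ c) - 1) =O[atTop]
      (fun x : ℝ => x⁻¹) := by
  refine IsBigO.of_bound 1 ?_
  filter_upwards [eventually_gt_atTop 0] with x hx
  have hD : 0 < Real.Gamma x * x ^ c :=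
    mul_pos (Real.Gamma_pos_of_pos hx) (rpow_pos_of_pos hx c)
  have hxc : 0 < x + c := by linarith
  have hle : Real.Gamma (x + c) / (Real.Gamma x * x ^ c) ≤ 1 :=
    (div_le_one hD).2 (Gamma_add_le_Gamma_mul_rpow hx h0 h1)
  have hge : x / (x + c) ≤ Real.Gamma (x + c) / (Real.Gamma x * x ^ c) := by
    rw [div_le_div_iff₀ hxc hD, mul_comm x]
    exact Gamma_mul_rpow_mul_le hx h0 h1
  have hinv : 1 - x⁻¹ ≤ x / (x + c) := by
    rw [le_div_iff₀ hxc]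
    have : (1 - x⁻¹) * (x + c) = x - (1 - c) - c * x⁻¹ := by
      field_simp
      ring
    have : 0 ≤ c * x⁻¹ := by positivity
    linarith
  rw [Real.norm_eq_abs, abs_of_nonpos (by linarith), norm_inv, Real.norm_of_nonneg hx.le]
  linarith

/-- If `f = 1 + O(1 / x)` then `f → 1` at infinity. -/
theorem tendsto_one_of_isBigO_sub_one {f : ℝ → ℝ}
    (hf : (fun x => f x - 1) =O[atTop] (fun x : ℝ => x⁻¹)) : Tendsto f atTop (nhds 1) := by
  simpa using (hf.trans_tendsto tendsto_inv_atTop_zero).add_const 1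

/-- `Γ(x + c) / (Γ(x) x ^ c) = 1 + O(1 / x)` as `x → ∞`, for `0 ≤ c`. -/
theorem isBigO_Gamma_add_div_sub_one {c : ℝ} (hc : 0 ≤ c) :
    (fun x : ℝ => Real.Gamma (x + c) / (Real.Gamma x * x ^ c) - 1) =O[atTop]
      (fun x : ℝ => x⁻¹) := by
  have step : ∀ (n : ℕ) (r : ℝ), 0 ≤ r → r ≤ 1 →
      (fun x : ℝ => Real.Gamma (x + (r + n)) / (Real.Gamma x * x ^ (r + n)) - 1) =O[atTop]
        (fun x : ℝ => x⁻¹) := by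
    intro n r hr0 hr1
    induction n with
    | zero => simpa using isBigO_Gamma_add_div_sub_one_of_le_one hr0 hr1
    | succ n ih =>
      have hO := ((tendsto_one_of_isBigO_sub_one ih).isBigO_one ℝ).mul
        ((isBigO_refl (fun x : ℝ => x⁻¹) atTop).const_mul_left (r + n))
      simp only [one_mul] at hO
      refine (ih.add hO).congr' ?_ .rfl
      filter_upwards [eventually_gt_atTop 0] with x hx
      have hd : 0 < x + (r + n) := by positivity
      have hG := Real.Gamma_pos_of_pos hx
      have hp := rpow_pos_of_pos hx (r + n)
      rw [Nat.cast_succ, show x + (r + ((n : ℝ) + 1)) = x + (r + n) + 1 by ring,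
        show r + ((n : ℝ) + 1) = r + n + 1 by ring, Real.Gamma_add_one hd.ne',
        rpow_add_one hx.ne']
      field_simp
      ring
  have h := step ⌊c⌋₊ (c - ⌊c⌋₊) (sub_nonneg.2 (Nat.floor_le hc))
    (by linarith [Nat.lt_floor_add_one c])
  simpa only [sub_add_cancel] using h

/-- `Γ(x + c) / Γ(x + d) = x ^ (c - d) + O(x ^ (c - d - 1))` as `x → ∞`. -/
theorem isBigO_Gamma_add_div_Gamma_add_sub_rpow {c d : ℝ} (hc : 0 ≤ c) (hd : 0 ≤ d) :
    (fun x : ℝ => Real.Gamma (x + c) / Real.Gamma (x + d) - x ^ (c - d)) =O[atTop]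
      (fun x : ℝ => x ^ (c - d - 1)) := by
  have hC := isBigO_Gamma_add_div_sub_one hc
  have hD := isBigO_Gamma_add_div_sub_one hd
  have hinv := ((tendsto_one_of_isBigO_sub_one hD).inv₀ one_ne_zero).isBigO_one ℝ
  have h := ((hC.sub hD).mul hinv).mul (isBigO_refl (fun x : ℝ => x ^ (c - d)) atTop)
  refine h.congr' ?_ ?_
  · filter_upwards [eventually_gt_atTop 0] with x hx
    have hG := Real.Gamma_pos_of_pos hx
    have hGd := Real.Gamma_pos_of_pos (show 0 < x + d by linarith)
    have hpc := rpow_pos_of_pos hx c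
    have hpd := rpow_pos_of_pos hx d
    rw [rpow_sub hx]
    field_simp
    ring
  · filter_upwards [eventually_gt_atTop 0] with x hx
    rw [rpow_sub_one hx.ne']
    ring

/-- for `0 < a ≤ b`, the Beta-fragmentation exponent
`φ(x) = 1 − E[B^{x+1}] − E[(1−B)^{x+1}]`, `B ∼ Beta(a,b)`, satisfies
`φ(x) = 1 − (Γ(a+b)/Γ(b))x^{−a} − (Γ(a+b)/Γ(a))x^{−b} + O(x^{−a−1})` as `x → ∞`. -/
theorem beta_fragmentation_phi_asymptotic (a b : ℝ) (ha : 0 < a) (hab : a ≤ b) :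
    (fun x : ℝ =>
        (1 - (Real.Gamma (a + b) / (Real.Gamma a * Real.Gamma b)) *
            ∫ u in (0:ℝ)..1,
              (u ^ (x + a) * (1 - u) ^ (b - 1) + u ^ (a - 1) * (1 - u) ^ (x + b)))
          - (1 - (Real.Gamma (a + b) / Real.Gamma b) * x ^ (-a)
              - (Real.Gamma (a + b) / Real.Gamma a) * x ^ (-b)))
      =O[atTop] (fun x : ℝ => x ^ (-a - 1)) := by
  have hb : 0 < b := ha.trans_le hab
  have h₁ := isBigO_Gamma_add_div_Gamma_add_sub_rpow (c := a + 1) (d := a + b + 1)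
    (by linarith) (by linarith)
  have h₂ := isBigO_Gamma_add_div_Gamma_add_sub_rpow (c := b + 1) (d := a + b + 1)
    (by linarith) (by linarith)
  rw [show a + 1 - (a + b + 1) = -b by ring] at h₁
  rw [show b + 1 - (a + b + 1) = -a by ring] at h₂
  have hba : (fun x : ℝ => x ^ (-b - 1)) =O[atTop] (fun x : ℝ => x ^ (-a - 1)) := by
    refine IsBigO.of_bound 1 ?_
    filter_upwards [eventually_ge_atTop 1] with x hx
    have hx0 : 0 ≤ x := by linarith
    rw [one_mul, Real.norm_of_nonneg (rpow_nonneg hx0 _), Real.norm_of_nonneg (rpow_nonneg hx0 _)]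
    exact rpow_le_rpow_of_exponent_le hx (by linarith)
  refine (((h₁.trans hba).const_mul_left (-(Real.Gamma (a + b) / Real.Gamma a))).add
    (h₂.const_mul_left (-(Real.Gamma (a + b) / Real.Gamma b)))).congr' ?_ .rfl
  filter_upwards [eventually_gt_atTop 0] with x hx
  have hp : 0 < x + a + 1 := by linarith
  have hq : 0 < x + b + 1 := by linarith
  have hi₁ := intervalIntegrable_rpow_mul_one_sub_rpow hp hb
  have hi₂ := intervalIntegrable_rpow_mul_one_sub_rpow ha hq
  have hv₁ := integral_rpow_mul_one_sub_rpow hp hb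
  have hv₂ := integral_rpow_mul_one_sub_rpow ha hq
  simp only [add_sub_cancel_right] at hi₁ hi₂ hv₁ hv₂
  rw [intervalIntegral.integral_add hi₁ hi₂, hv₁, hv₂,
    show x + a + 1 + b = x + (a + b + 1) by ring,
    show a + (x + b + 1) = x + (a + b + 1) by ring, add_assoc x a 1, add_assoc x b 1]
  have hGa := Real.Gamma_pos_of_pos ha
  have hGb := Real.Gamma_pos_of_pos hb
  have hG := Real.Gamma_pos_of_pos (show 0 < x + (a + b + 1) by linarith)
  field_simp
  ring
end

section
/- Let a ∈ (1/3, 1/2] and b ∈ (1/2, 1). Let φ:(0,∞)→(0,∞) be increasing with x ↦ x/φ(x) strictly increasing with range an interval (x_ψ,∞), and assume that φ(x) = 1 − (Γ(a+b)/Γ(b))·x^{−a} − (Γ(a+b)/Γ(a))·x^{−b} + O(x^{−a−1}) as x → ∞. Then as x → ∞, ψ(x)/x = 1 − Γ(a+b)/(Γ(b)·x^{a}) − Γ(a+b)/(Γ(a)·x^{b}) − a·Γ(a+b)²/(Γ(b)²·x^{2a}) − (a+b)·Γ(a+b)²/(Γ(a)Γ(b)·x^{a+b}) + O(x^{−2b})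 + O(x^{−3a}) + O(x^{−a−1}). -/
open Filter Asymptotics Real

/-- First-order Taylor expansion of a real power at `1`, with quadratic remainder. -/
theorem rpow_sub_linear_isBigO_sq (c : ℝ) :
    (fun u : ℝ => u ^ c - 1 - c * (u - 1)) =O[nhds 1] (fun u : ℝ => (u - 1) ^ 2) := by
  have hderiv : ∀ u : ℝ, 0 < u →
      HasDerivAt (fun u : ℝ => u ^ c - 1 - c * (u - 1)) (c * (u ^ (c - 1) - 1)) u := by
    intro u hu
    have h1 := (Real.hasDerivAt_rpow_const (x := u) (p := c) (Or.inl hu.ne')).sub_const 1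
    have h2 := ((hasDerivAt_id u).sub_const 1).const_mul c
    exact (h1.sub h2).congr_deriv (by ring)
  have hO : (fun u : ℝ => c * (u ^ (c - 1) - 1)) =O[nhds 1] (fun u : ℝ => u - 1) := by
    have h := (Real.hasDerivAt_rpow_const (x := 1) (p := c - 1)
      (Or.inl one_ne_zero)).isBigO_sub.const_mul_left c
    simpa using h
  obtain ⟨K, hKpos, hK⟩ := hO.exists_pos
  obtain ⟨δ, hδ, hball⟩ := Metric.eventually_nhds_iff_ball.1
    (hK.bound.and (lt_mem_nhds (zero_lt_one (α := ℝ))))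
  refine IsBigO.of_bound K (Metric.eventually_nhds_iff_ball.2 ⟨δ, hδ, fun x hx => ?_⟩)
  have hsub : ∀ v ∈ Metric.closedBall (1 : ℝ) |x - 1|, v ∈ Metric.ball (1 : ℝ) δ := by
    intro v hv
    rw [Metric.mem_closedBall] at hv
    rw [Metric.mem_ball, Real.dist_eq] at hx
    exact lt_of_le_of_lt hv hx
  have hmvt := (convex_closedBall (1 : ℝ) |x - 1|).norm_image_sub_le_of_norm_hasDerivWithin_le
    (f := fun u : ℝ => u ^ c - 1 - c * (u - 1)) (f' := fun u => c * (u ^ (c - 1) - 1))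
    (C := K * |x - 1|) (x := 1) (y := x)
    (fun v hv => (hderiv v (hball v (hsub v hv)).2).hasDerivWithinAt)
    (fun v hv => (hball v (hsub v hv)).1.trans (by
      rw [Metric.mem_closedBall, Real.dist_eq] at hv
      exact mul_le_mul_of_nonneg_left hv hKpos.le))
    (Metric.mem_closedBall_self (abs_nonneg _))
    (by rw [Metric.mem_closedBall, Real.dist_eq])
  simp only [Real.one_rpow, sub_self, mul_zero, sub_zero] at hmvt
  refine hmvt.trans (le_of_eq ?_)
  rw [norm_pow, Real.norm_eq_abs]
  ring

/-- If `u → 1` solves `u = 1 - A P u⁻ᵃ - B Q u⁻ᵇ + O(R)` with `Q = O(P)`, `R = O(P²)` and `P`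
bounded, then `u` has the corresponding second-order expansion in `P` and `Q`. -/
theorem implicit_second_order_expansion {l : Filter ℝ} {a b A B : ℝ} {u P Q R : ℝ → ℝ}
    (hu : Tendsto u l (nhds 1)) (hP : P =O[l] (fun _ => (1 : ℝ))) (hQP : Q =O[l] P)
    (hRP : R =O[l] fun x => P x ^ 2)
    (hP0 : ∀ᶠ x in l, 0 ≤ P x) (hR0 : ∀ᶠ x in l, 0 ≤ R x)
    (he : (fun x => u x - (1 - A * (P x * u x ^ (-a)) - B * (Q x * u x ^ (-b)))) =O[l] R) :
    (fun x => u x - (1 - A * P x - B * Q x - a * A ^ 2 * P x ^ 2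
      - (a + b) * (A * B) * (P x * Q x))) =O[l] (fun x => Q x ^ 2 + P x ^ 3 + R x) := by
  have hpow : ∀ c : ℝ, (fun x => u x ^ c) =O[l] (fun _ => (1 : ℝ)) := fun c =>
    ((continuousAt_rpow_const 1 c (Or.inl one_ne_zero)).tendsto.comp hu).isBigO_one ℝ
  have hT : ∀ c : ℝ, (fun x => u x ^ c - 1 - c * (u x - 1)) =O[l] (fun x => (u x - 1) ^ 2) :=
    fun c => (rpow_sub_linear_isBigO_sq c).comp_tendsto hu
  have hPP : (fun x => P x ^ 2) =O[l] P := by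
    simpa [pow_two] using hP.mul (isBigO_refl P l)
  have hPs : ∀ c : ℝ, (fun x => P x * u x ^ c) =O[l] P := fun c => by
    simpa using (isBigO_refl P l).mul (hpow c)
  have hQt : ∀ c : ℝ, (fun x => Q x * u x ^ c) =O[l] P := fun c => by
    simpa using hQP.mul (hpow c)
  have hv : (fun x => u x - 1) =O[l] P := by
    have h := ((he.trans (hRP.trans hPP)).sub ((hPs (-a)).const_mul_left A)).sub
      ((hQt (-b)).const_mul_left B)
    refine h.congr_left fun x => ?_
    ring
  have hT2 : ∀ c : ℝ, (fun x => u x ^ c - 1 - c * (u x - 1)) =O[l] (fun x => P x ^ 2) :=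
    fun c => (hT c).trans (hv.pow 2)
  have hT1 : ∀ c : ℝ, (fun x => u x ^ c - 1) =O[l] P := fun c => by
    refine (((hT2 c).trans hPP).add (hv.const_mul_left c)).congr_left fun x => ?_
    ring
  have hw : (fun x => u x - 1 + A * P x + B * Q x) =O[l] (fun x => P x ^ 2) := by
    have h1 : (fun x => P x * (u x ^ (-a) - 1)) =O[l] (fun x => P x ^ 2) := by
      simpa [pow_two] using (isBigO_refl P l).mul (hT1 (-a))
    have h2 : (fun x => Q x * (u x ^ (-b) - 1)) =O[l] (fun x => P x ^ 2) := by
      simpa [pow_two] using hQP.mul (hT1 (-b))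
    refine (((he.trans hRP).sub (h1.const_mul_left A)).sub
      (h2.const_mul_left B)).congr_left fun x => ?_
    ring
  have hcube : ∀ {f g : ℝ → ℝ}, f =O[l] P → g =O[l] (fun x => P x ^ 2) →
      (fun x => f x * g x) =O[l] (fun x => P x ^ 3) := fun hf hg =>
    (hf.mul hg).congr_right fun x => by ring
  have hQ2 : (fun x => Q x ^ 2) =O[l] (fun x => Q x ^ 2 + P x ^ 3 + R x) := by
    refine IsBigO.of_bound' ?_
    filter_upwards [hP0, hR0] with x h1 h2
    rw [Real.norm_of_nonneg (by positivity), Real.norm_of_nonneg (by positivity)]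
    nlinarith [pow_nonneg h1 3]
  have hP3 : (fun x => P x ^ 3) =O[l] (fun x => Q x ^ 2 + P x ^ 3 + R x) := by
    refine IsBigO.of_bound' ?_
    filter_upwards [hP0, hR0] with x h1 h2
    rw [Real.norm_of_nonneg (by positivity), Real.norm_of_nonneg (by positivity)]
    nlinarith [sq_nonneg (Q x)]
  have hR : R =O[l] (fun x => Q x ^ 2 + P x ^ 3 + R x) := by
    refine IsBigO.of_bound' ?_
    filter_upwards [hP0, hR0] with x h1 h2
    rw [Real.norm_of_nonneg (by positivity), Real.norm_of_nonneg (by positivity)]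
    nlinarith [sq_nonneg (Q x), pow_nonneg h1 3]
  have hPr := isBigO_refl P l
  have h1 := ((hcube hPr (hT2 (-a))).const_mul_left A).trans hP3
  have h2 := ((hcube hQP (hT2 (-b))).const_mul_left B).trans hP3
  have h3 := ((hcube hPr hw).const_mul_left (a * A)).trans hP3
  have h4 := ((hcube hQP hw).const_mul_left (b * B)).trans hP3
  have h5 := hQ2.const_mul_left (b * B ^ 2)
  refine ((((((he.trans hR).sub h1).sub h2).add h3).add h4).sub h5).congr_left fun x => ?_
  ring

/-- for `a ∈ (1/3,1/2]`, `b ∈ (1/2,1)` and `φ` with the Beta-type expansion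
`φ(x) = 1 − (Γ(a+b)/Γ(b))x^{−a} − (Γ(a+b)/Γ(a))x^{−b} + O(x^{−a−1})`, the inverse `ψ`
of `x ↦ x/φ(x)` satisfies the stated second-order expansion of `ψ(x)/x`. -/
theorem psi_expansion_beta_case
    (a b : ℝ) (ha : a ∈ Set.Ioc (1/3 : ℝ) (1/2)) (hb : b ∈ Set.Ioo (1/2 : ℝ) 1)
    (φ ψ : ℝ → ℝ) (xψ : ℝ)
    (hφpos : ∀ x > (0:ℝ), 0 < φ x)
    (hφmono : MonotoneOn φ (Set.Ioi 0))
    (hratio : StrictMonoOn (fun x => x / φ x) (Set.Ioi 0))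
    (hrange : (fun x => x / φ x) '' Set.Ioi 0 = Set.Ioi xψ)
    (hψpos : ∀ y > xψ, 0 < ψ y)
    (hψinv : ∀ y > xψ, ψ y / φ (ψ y) = y)
    (hφexp : (fun x : ℝ => φ x - (1 - (Real.Gamma (a + b) / Real.Gamma b) * x ^ (-a)
          - (Real.Gamma (a + b) / Real.Gamma a) * x ^ (-b)))
        =O[atTop] (fun x : ℝ => x ^ (-a - 1))) :
    (fun x : ℝ => ψ x / x -
        (1 - Real.Gamma (a + b) / (Real.Gamma b * x ^ a)
           - Real.Gamma (a + b) / (Real.Gamma a * x ^ b)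
           - a * (Real.Gamma (a + b)) ^ 2 / ((Real.Gamma b) ^ 2 * x ^ (2 * a))
           - (a + b) * (Real.Gamma (a + b)) ^ 2 /
               (Real.Gamma a * Real.Gamma b * x ^ (a + b))))
      =O[atTop] (fun x : ℝ => x ^ (-2 * b) + x ^ (-3 * a) + x ^ (-a - 1)) := by
  obtain ⟨ha1, ha2⟩ := ha
  obtain ⟨hb1, hb2⟩ := hb
  have hψtop : Tendsto ψ atTop atTop := by
    refine tendsto_atTop.2 fun M => ?_
    have hM : (0 : ℝ) < max M 1 := lt_max_of_lt_right one_pos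
    filter_upwards [eventually_gt_atTop xψ, eventually_gt_atTop (max M 1 / φ (max M 1))]
      with y hy1 hy2
    have hlt : max M 1 / φ (max M 1) < ψ y / φ (ψ y) := by rwa [hψinv y hy1]
    exact (le_max_left M 1).trans ((hratio.lt_iff_lt hM (hψpos y hy1)).1 hlt).le
  have hzero : ∀ c : ℝ, 0 < c → Tendsto (fun x : ℝ => x ^ (-c)) atTop (nhds 0) :=
    fun c hc => tendsto_rpow_neg_atTop hc
  have hφ1 : Tendsto φ atTop (nhds 1) := by
    have h0 : Tendsto (fun x : ℝ => x ^ (-a - 1)) atTop (nhds 0) := by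
      have h := hzero (a + 1) (by linarith)
      rwa [show -(a + 1) = -a - 1 by ring] at h
    have h := (hφexp.trans_tendsto h0).add
      ((tendsto_const_nhds (x := (1 : ℝ)).sub
        ((hzero a (by linarith)).const_mul (Real.Gamma (a + b) / Real.Gamma b))).sub
        ((hzero b (by linarith)).const_mul (Real.Gamma (a + b) / Real.Gamma a)))
    simpa using h
  have hφψ : ∀ᶠ y in atTop, φ (ψ y) = ψ y / y := by
    filter_upwards [eventually_gt_atTop xψ, eventually_gt_atTop 0] with y hy1 hy2
    have h := hψinv y hy1
    rw [div_eq_iff (hφpos _ (hψpos y hy1)).ne'] at h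
    rw [eq_div_iff hy2.ne', mul_comm]
    exact h.symm
  have hu : Tendsto (fun y => ψ y / y) atTop (nhds 1) :=
    (hφ1.comp hψtop).congr' hφψ
  have hψpow : ∀ c : ℝ, ∀ᶠ y in atTop, ψ y ^ c = y ^ c * (ψ y / y) ^ c := by
    intro c
    filter_upwards [eventually_gt_atTop xψ, eventually_gt_atTop 0] with y hy1 hy2
    rw [← Real.mul_rpow hy2.le (div_pos (hψpos y hy1) hy2).le, mul_div_cancel₀ _ hy2.ne']
  have hψR : (fun y => ψ y ^ (-a - 1)) =O[atTop] (fun y : ℝ => y ^ (-a - 1)) := by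
    have h1 : (fun y => (ψ y / y) ^ (-a - 1)) =O[atTop] (fun _ => (1 : ℝ)) :=
      ((continuousAt_rpow_const 1 (-a - 1) (Or.inl one_ne_zero)).tendsto.comp hu).isBigO_one ℝ
    have h2 := (isBigO_refl (fun y : ℝ => y ^ (-a - 1)) atTop).mul h1
    simp only [mul_one] at h2
    exact h2.congr' ((hψpow (-a - 1)).mono fun y hy => hy.symm) EventuallyEq.rfl
  have he : (fun y => ψ y / y - (1 - Real.Gamma (a + b) / Real.Gamma b *
      (y ^ (-a) * (ψ y / y) ^ (-a)) - Real.Gamma (a + b) / Real.Gamma a *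
      (y ^ (-b) * (ψ y / y) ^ (-b)))) =O[atTop] (fun y : ℝ => y ^ (-a - 1)) := by
    refine ((hφexp.comp_tendsto hψtop).trans hψR).congr' ?_ EventuallyEq.rfl
    filter_upwards [hφψ, hψpow (-a), hψpow (-b)] with y h1 h2 h3
    simp only [Function.comp_apply]
    rw [h1, h2, h3]
  have hle : ∀ {c d : ℝ}, c ≤ d → (fun y : ℝ => y ^ c) =O[atTop] (fun y : ℝ => y ^ d) := by
    intro c d hcd
    refine IsBigO.of_bound' ?_
    filter_upwards [eventually_ge_atTop 1] with y hy
    rw [Real.norm_of_nonneg (by positivity), Real.norm_of_nonneg (by positivity)]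
    exact Real.rpow_le_rpow_of_exponent_le hy hcd
  have hsq : ∀ c : ℝ, ∀ n : ℕ, ∀ y : ℝ, 0 < y → (y ^ c) ^ n = y ^ (c * n) :=
    fun c n y hy => (Real.rpow_mul_natCast hy.le c n).symm
  have hRP : (fun y : ℝ => y ^ (-a - 1)) =O[atTop] (fun y : ℝ => (y ^ (-a)) ^ 2) := by
    refine (hle (d := -a * (2 : ℕ)) (by push_cast; linarith)).congr' EventuallyEq.rfl ?_
    filter_upwards [eventually_gt_atTop 0] with y hy
    exact (hsq _ _ y hy).symm
  have hmain := implicit_second_order_expansion hu ((hzero a (by linarith)).isBigO_one ℝ)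
    (hle (neg_le_neg (ha2.trans hb1.le))) hRP
    ((eventually_ge_atTop 0).mono fun y hy => Real.rpow_nonneg hy _)
    ((eventually_ge_atTop 0).mono fun y hy => Real.rpow_nonneg hy _) he
  refine hmain.congr' ?_ ?_
  · filter_upwards [eventually_gt_atTop 0] with y hy
    have h2 : y ^ (2 * a) = (y ^ a) ^ 2 := by rw [hsq a 2 y hy]; push_cast; ring_nf
    rw [Real.rpow_add hy, h2, Real.rpow_neg hy.le, Real.rpow_neg hy.le]
    simp only [div_eq_mul_inv, mul_inv, mul_pow, inv_pow]
    ring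
  · filter_upwards [eventually_gt_atTop 0] with y hy
    rw [hsq _ _ y hy, hsq _ _ y hy]
    push_cast
    ring_nf
end
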